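/- Let (E,ρ) be a Polish metric space, T>0, and let x↦P^x be a measurable family of probability measures on E_T = C([0,T];E) with P^x∘u₀^{-1}=δ_x for every x∈E, where u₀(ξ)=ξ₀; set P^μ = ∫_E P^x μ(dx). Assume the Talagrand inequality W_{2,T}(Q',P^x)² ≤ c₁ H(Q'|P^x) holds for every x∈E and every Q'∈P(E_T), with a constant c₁∈(0,∞). Let F: E_T → [0,∞) be measurable with ∫ F dP^μ = 1, let Q = F·P^μ, let p(x) = ∫_{E_T} F dP^x, and let ν(dx) = p(x)μ(dx). Then W_{2,T}(Q, P^ν)² ≤ c₁ H(Q|P^μ). -/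

import Mathlib

open MeasureTheory ENNReal
open scoped Classical

/-- The squared quadratic Wasserstein distance `W₂(μ,ν)²`:
the infimum over all couplings `π` of `μ` and `ν` of `∫ d(x,y)² dπ`. -/
noncomputable def W2sq {X : Type*} [MeasurableSpace X] [MetricSpace X]
    (μ ν : Measure X) : ℝ≥0∞ :=
  ⨅ (π : Measure (X × X)) (_ : π.map Prod.fst = μ ∧ π.map Prod.snd = ν),
    ∫⁻ p, ENNReal.ofReal (dist p.1 p.2 ^ 2) ∂π

/-- The relative entropy `H(μ|ν) = ∫ log (dμ/dν) dμ` if `μ ≪ ν`, and `∞` otherwise.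
For probability measures it is written, with `f = dμ/dν`, as the (always defined)
integral `∫ (f log f - f + 1) dν` of a nonnegative integrand, which coincides with
`∫ f log f dν = ∫ log (dμ/dν) dμ` since `∫ (1 - f) dν = 0`. -/
noncomputable def relEntropy {X : Type*} [MeasurableSpace X] (μ ν : Measure X) : ℝ≥0∞ :=
  if μ ≪ ν then
    ∫⁻ x, ENNReal.ofReal
      ((μ.rnDeriv ν x).toReal * Real.log ((μ.rnDeriv ν x).toReal)
        - (μ.rnDeriv ν x).toReal + 1) ∂ν
  else ⊤

/-- The free path space `E_T = C([0,T];E)`, equipped with the uniform metric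
`ρ_T(ξ,η) = sup_{t∈[0,T]} ρ(ξ_t,η_t)` (the `MetricSpace` instance on continuous
maps from a compact space) and its Borel σ-algebra. -/
abbrev PathSpace (E : Type*) [MetricSpace E] (T : ℝ) := C(Set.Icc (0:ℝ) T, E)

noncomputable instance pathMS (E : Type*) [MetricSpace E] (T : ℝ) :
    MeasurableSpace (PathSpace E T) := borel _

instance (E : Type*) [MetricSpace E] (T : ℝ) : BorelSpace (PathSpace E T) := ⟨rfl⟩

open ProbabilityTheory Filter Topology
open scoped NNReal

section Completion

variable {X Y : Type*} [MeasurableSpace X] [MeasurableSpace Y]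

/-- The density of the first marginal of `s · (Q ⊗ P)` with respect to `Q`. -/
noncomputable def rowMass (s : X × Y → ℝ≥0∞) (P : Measure Y) (a : X) : ℝ≥0∞ :=
  ∫⁻ b, s (a, b) ∂P

/-- The density of the second marginal of `s · (Q ⊗ P)` with respect to `P`. -/
noncomputable def colMass (s : X × Y → ℝ≥0∞) (Q : Measure X) (b : Y) : ℝ≥0∞ :=
  ∫⁻ a, s (a, b) ∂Q

/-- The mass of `Q` that `s · (Q ⊗ P)` leaves uncoupled. -/
noncomputable def defect (s : X × Y → ℝ≥0∞) (Q : Measure X) (P : Measure Y) : ℝ≥0∞ :=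
  ∫⁻ a, (1 - rowMass s P a) ∂Q

/-- The density with respect to `Q ⊗ P` of the coupling that extends the partial coupling
`s · (Q ⊗ P)` by the normalized product of the two uncoupled parts. -/
noncomputable def completedDensity (s : X × Y → ℝ≥0∞) (Q : Measure X) (P : Measure Y)
    (z : X × Y) : ℝ≥0∞ :=
  s z + (1 - rowMass s P z.1) * (1 - colMass s Q z.2) / defect s Q P

/-- `s · (Q ⊗ P)` is a partial coupling of `Q` and `P`. -/
def IsSubcoupling (s : X × Y → ℝ≥0∞) (Q : Measure X) (P : Measure Y) : Prop :=
  (∀ᵐ a ∂Q, rowMass s P a ≤ 1) ∧ ∀ᵐ b ∂P, colMass s Q b ≤ 1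

/-- The coupling of `Q` and `P` with density `completedDensity s Q P`. -/
noncomputable def completion (s : X × Y → ℝ≥0∞) (Q : Measure X) (P : Measure Y) :
    Measure (X × Y) :=
  (Q.prod P).withDensity (completedDensity s Q P)

variable {s : X × Y → ℝ≥0∞} {Q : Measure X} {P : Measure Y}
  [IsProbabilityMeasure Q] [IsProbabilityMeasure P]

@[fun_prop]
lemma measurable_rowMass (hs : Measurable s) : Measurable (rowMass s P) :=
  hs.lintegral_prod_right'

@[fun_prop]
lemma measurable_colMass (hs : Measurable s) : Measurable (colMass s Q) :=
  hs.lintegral_prod_left'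

lemma measurable_completedDensity (hs : Measurable s) :
    Measurable (completedDensity s Q P) :=
  hs.add ((((measurable_rowMass hs).comp measurable_fst).const_sub 1 |>.mul
    (((measurable_colMass hs).comp measurable_snd).const_sub 1)).div_const _)

lemma lintegral_one_sub {α : Type*} [MeasurableSpace α] {μ : Measure α} [IsProbabilityMeasure μ]
    {f : α → ℝ≥0∞} (hf : Measurable f) (h : ∀ᵐ a ∂μ, f a ≤ 1) :
    ∫⁻ a, (1 - f a) ∂μ = 1 - ∫⁻ a, f a ∂μ := by
  have hle : ∫⁻ a, f a ∂μ ≤ 1 := (lintegral_mono_ae h).trans (by simp)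
  rw [lintegral_sub hf (ne_top_of_le_ne_top one_ne_top hle) h]
  simp

lemma lintegral_rowMass (hs : Measurable s) :
    ∫⁻ a, rowMass s P a ∂Q = ∫⁻ b, colMass s Q b ∂P := by
  unfold rowMass colMass
  rw [← lintegral_prod _ hs.aemeasurable, lintegral_prod_symm' _ hs]

lemma lintegral_one_sub_colMass (hs : Measurable s) (h : IsSubcoupling s Q P) :
    ∫⁻ b, (1 - colMass s Q b) ∂P = defect s Q P := by
  rw [defect, lintegral_one_sub (measurable_colMass hs) h.2,
    lintegral_one_sub (measurable_rowMass hs) h.1, lintegral_rowMass hs]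

omit [IsProbabilityMeasure P] in
lemma defect_ne_top : defect s Q P ≠ ∞ := by
  refine ne_top_of_le_ne_top one_ne_top ((lintegral_mono fun a => tsub_le_self).trans ?_)
  simp

omit [IsProbabilityMeasure P] in
lemma mul_defect_div {a : ℝ≥0∞} (h : defect s Q P = 0 → a = 0) :
    a * defect s Q P / defect s Q P = a := by
  by_cases h0 : defect s Q P = 0
  · simp [h h0]
  · exact ENNReal.mul_div_cancel_right h0 defect_ne_top

lemma lintegral_completedDensity_right (hs : Measurable s) (h : IsSubcoupling s Q P) :
    ∀ᵐ a ∂Q, ∫⁻ b, completedDensity s Q P (a, b) ∂P = 1 := by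
  have h0 : ∀ᵐ a ∂Q, defect s Q P = 0 → 1 - rowMass s P a = 0 := by
    by_cases hd : defect s Q P = 0
    · filter_upwards [(lintegral_eq_zero_iff ((measurable_rowMass hs).const_sub 1)).1 hd]
        with a ha _ using ha
    · exact Eventually.of_forall fun a h => absurd h hd
  filter_upwards [h.1, h0] with a ha ha0
  simp only [completedDensity, mul_div_assoc]
  rw [lintegral_add_left (f := fun b => s (a, b)) (hs.comp measurable_prodMk_left),
    lintegral_const_mul' _ _ (by simp)]
  simp only [div_eq_mul_inv]
  rw [lintegral_mul_const _ ((measurable_colMass hs).const_sub 1),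
    lintegral_one_sub_colMass hs h, ← mul_assoc, ← div_eq_mul_inv, mul_defect_div ha0]
  exact add_tsub_cancel_of_le ha

lemma lintegral_completedDensity_left (hs : Measurable s) (h : IsSubcoupling s Q P) :
    ∀ᵐ b ∂P, ∫⁻ a, completedDensity s Q P (a, b) ∂Q = 1 := by
  have h0 : ∀ᵐ b ∂P, defect s Q P = 0 → 1 - colMass s Q b = 0 := by
    by_cases hd : defect s Q P = 0
    · rw [← lintegral_one_sub_colMass hs h] at hd
      filter_upwards [(lintegral_eq_zero_iff ((measurable_colMass hs).const_sub 1)).1 hd]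
        with a ha _ using ha
    · exact Eventually.of_forall fun a h => absurd h hd
  filter_upwards [h.2, h0] with b hb hb0
  simp only [completedDensity, mul_comm (1 - rowMass s P _), mul_div_assoc]
  rw [lintegral_add_left (f := fun a => s (a, b)) (hs.comp measurable_prodMk_right),
    lintegral_const_mul' _ _ (by simp)]
  simp only [div_eq_mul_inv]
  rw [lintegral_mul_const _ ((measurable_rowMass hs).const_sub 1)]
  change _ + _ * (defect s Q P * _) = _
  rw [← mul_assoc, ← div_eq_mul_inv, mul_defect_div hb0]
  exact add_tsub_cancel_of_le hb

omit [IsProbabilityMeasure Q] in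
lemma map_fst_withDensity_prod {D : X × Y → ℝ≥0∞} (hD : Measurable D)
    (h : ∀ᵐ a ∂Q, ∫⁻ b, D (a, b) ∂P = 1) :
    ((Q.prod P).withDensity D).map Prod.fst = Q := by
  ext A hA
  rw [Measure.map_apply measurable_fst hA, withDensity_apply _ (measurable_fst hA),
    ← lintegral_indicator (measurable_fst hA),
    lintegral_prod _ (hD.indicator (measurable_fst hA)).aemeasurable]
  have : ∀ᵐ a ∂Q, ∫⁻ b, (Prod.fst ⁻¹' A).indicator D (a, b) ∂P = A.indicator 1 a := by
    filter_upwards [h] with a ha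
    by_cases haA : a ∈ A <;> simp [Set.indicator, haA, ha]
  rw [lintegral_congr_ae this, lintegral_indicator_one hA]

lemma map_snd_withDensity_prod {D : X × Y → ℝ≥0∞} (hD : Measurable D)
    (h : ∀ᵐ b ∂P, ∫⁻ a, D (a, b) ∂Q = 1) :
    ((Q.prod P).withDensity D).map Prod.snd = P := by
  ext A hA
  rw [Measure.map_apply measurable_snd hA, withDensity_apply _ (measurable_snd hA),
    ← lintegral_indicator (measurable_snd hA),
    lintegral_prod_symm' _ (hD.indicator (measurable_snd hA))]
  have : ∀ᵐ b ∂P, ∫⁻ a, (Prod.snd ⁻¹' A).indicator D (a, b) ∂Q = A.indicator 1 b := by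
    filter_upwards [h] with b hb
    by_cases hbA : b ∈ A <;> simp [Set.indicator, hbA, hb]
  rw [lintegral_congr_ae this, lintegral_indicator_one hA]

lemma map_fst_completion (hs : Measurable s) (h : IsSubcoupling s Q P) :
    (completion s Q P).map Prod.fst = Q :=
  map_fst_withDensity_prod (measurable_completedDensity hs)
    (lintegral_completedDensity_right hs h)

lemma map_snd_completion (hs : Measurable s) (h : IsSubcoupling s Q P) :
    (completion s Q P).map Prod.snd = P :=
  map_snd_withDensity_prod (measurable_completedDensity hs)
    (lintegral_completedDensity_left hs h)

lemma lintegral_completion (hs : Measurable s) {c : X × Y → ℝ≥0∞} (hc : Measurable c) :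
    ∫⁻ z, c z ∂completion s Q P = ∫⁻ z, s z * c z ∂Q.prod P
      + ∫⁻ z, (1 - rowMass s P z.1) * (1 - colMass s Q z.2) / defect s Q P * c z ∂Q.prod P := by
  rw [completion, lintegral_withDensity_eq_lintegral_mul _ (measurable_completedDensity hs) hc,
    ← lintegral_add_left (f := fun z => s z * c z) (hs.mul hc)]
  simp only [Pi.mul_apply, completedDensity, add_mul]

lemma lintegral_remainder_le (hs : Measurable s) (h : IsSubcoupling s Q P)
    {c : X × Y → ℝ≥0∞} {u : X → ℝ≥0∞} {v : Y → ℝ≥0∞} (hu : Measurable u) (hv : Measurable v)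
    (hc : ∀ z, c z ≤ u z.1 + v z.2) :
    ∫⁻ z, (1 - rowMass s P z.1) * (1 - colMass s Q z.2) / defect s Q P * c z ∂Q.prod P
      ≤ ∫⁻ a, (1 - rowMass s P a) * u a ∂Q + ∫⁻ b, (1 - colMass s Q b) * v b ∂P := by
  have hr := (measurable_rowMass (P := P) hs).const_sub 1
  have hk := (measurable_colMass (Q := Q) hs).const_sub 1
  calc _ ≤ ∫⁻ z, ((1 - rowMass s P z.1) * u z.1) * ((1 - colMass s Q z.2) / defect s Q P)
          + ((1 - rowMass s P z.1) / defect s Q P) * ((1 - colMass s Q z.2) * v z.2) ∂Q.prod P := by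
        refine lintegral_mono fun z => (mul_le_mul_right (hc z) _).trans (le_of_eq ?_)
        simp only [div_eq_mul_inv]
        ring
    _ = (∫⁻ a, (1 - rowMass s P a) * u a ∂Q) * (defect s Q P / defect s Q P)
          + (defect s Q P / defect s Q P) * ∫⁻ b, (1 - colMass s Q b) * v b ∂P := by
        rw [lintegral_add_left (by fun_prop),
          lintegral_prod_mul (f := fun a => (1 - rowMass s P a) * u a)
            (g := fun b => (1 - colMass s Q b) / defect s Q P)
            (hr.mul hu).aemeasurable (hk.div_const _).aemeasurable,
          lintegral_prod_mul (f := fun a => (1 - rowMass s P a) / defect s Q P)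
            (g := fun b => (1 - colMass s Q b) * v b)
            (hr.div_const _).aemeasurable (hk.mul hv).aemeasurable]
        simp only [div_eq_mul_inv]
        rw [lintegral_mul_const _ hr, lintegral_mul_const _ hk, lintegral_one_sub_colMass hs h]
        rfl
    _ ≤ _ := add_le_add (mul_le_of_le_one_right' ENNReal.div_self_le_one)
        (mul_le_of_le_one_left' ENNReal.div_self_le_one)

end Completion

section Discretization

variable {X Y : Type*} [MeasurableSpace X] [MeasurableSpace Y]

lemma lintegral_right_eq_one_of_map_fst {Q : Measure X} {P : Measure Y} [IsFiniteMeasure Q]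
    [IsFiniteMeasure P] {D : X × Y → ℝ≥0∞} (hD : Measurable D)
    (h : ((Q.prod P).withDensity D).map Prod.fst = Q) :
    ∀ᵐ a ∂Q, ∫⁻ b, D (a, b) ∂P = 1 := by
  refine ae_eq_of_forall_setLIntegral_eq_of_sigmaFinite hD.lintegral_prod_right'
    measurable_const fun A hA _ => ?_
  rw [setLIntegral_one]
  conv_rhs => rw [← h, Measure.map_apply measurable_fst hA,
    withDensity_apply _ (measurable_fst hA), ← Set.prod_univ, ← Measure.prod_restrict,
    Measure.restrict_univ, lintegral_prod _ hD.aemeasurable]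

lemma lintegral_left_eq_one_of_map_snd {Q : Measure X} {P : Measure Y} [IsFiniteMeasure Q]
    [IsFiniteMeasure P] {D : X × Y → ℝ≥0∞} (hD : Measurable D)
    (h : ((Q.prod P).withDensity D).map Prod.snd = P) :
    ∀ᵐ b ∂P, ∫⁻ a, D (a, b) ∂Q = 1 := by
  refine ae_eq_of_forall_setLIntegral_eq_of_sigmaFinite hD.lintegral_prod_left'
    measurable_const fun A hA _ => ?_
  rw [setLIntegral_one]
  conv_rhs => rw [← h, Measure.map_apply measurable_snd hA,
    withDensity_apply _ (measurable_snd hA), ← Set.univ_prod, ← Measure.prod_restrict,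
    Measure.restrict_univ, lintegral_prod_symm' _ hD]

/-- A coupling on a countable space has a density with respect to the product coupling. -/
lemma exists_density_of_countable {π : Measure (ℕ × ℕ)} [IsFiniteMeasure π] :
    ∃ t : ℕ × ℕ → ℝ≥0, π = ((π.map Prod.fst).prod (π.map Prod.snd)).withDensity
      (fun z => (t z : ℝ≥0∞)) := by
  set κ := (π.map Prod.fst).prod (π.map Prod.snd) with hκ
  have hac : π ≪ κ := by
    refine Measure.AbsolutelyContinuous.mk fun A _ hA => ?_
    rw [← Set.biUnion_of_singleton A, measure_biUnion_null_iff A.to_countable]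
    rintro ⟨i, j⟩ hij
    have h0 : κ {(i, j)} = 0 := measure_mono_null (by simpa using hij) hA
    rw [← Set.singleton_prod_singleton, hκ, Measure.prod_prod, mul_eq_zero,
      Measure.map_apply measurable_fst (measurableSet_singleton i),
      Measure.map_apply measurable_snd (measurableSet_singleton j)] at h0
    rcases h0 with h0 | h0 <;> exact measure_mono_null (by simp) h0
  refine ⟨fun z => (π.rnDeriv κ z).toNNReal, ?_⟩
  conv_lhs => rw [← Measure.withDensity_rnDeriv_eq π κ hac]
  refine withDensity_congr_ae ?_
  filter_upwards [Measure.rnDeriv_lt_top π κ] with z hz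
  rw [ENNReal.coe_toNNReal hz.ne]

/-- The density `f / l` on a countable square, a member of a countable family. -/
noncomputable def ratDensity (f : ℕ × ℕ →₀ ℕ) (l : ℕ) (z : ℕ × ℕ) : ℝ≥0 := (f z : ℝ≥0) / l

lemma exists_ratDensity_tendsto (t : ℕ × ℕ → ℝ≥0) :
    ∃ f : ℕ → (ℕ × ℕ →₀ ℕ), (∀ l z, ratDensity (f l) l z ≤ t z) ∧
      ∀ z, Tendsto (fun l => ratDensity (f l) l z) atTop (𝓝 (t z)) := by
  refine ⟨fun l => Finsupp.onFinset (Finset.range l ×ˢ Finset.range l)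
    (fun z => if z ∈ Finset.range l ×ˢ Finset.range l then ⌊(t z : ℝ) * l⌋₊ else 0)
    (fun z hz => by by_contra h; simp [h] at hz), fun l z => ?_, fun z => ?_⟩
  · simp only [ratDensity, Finsupp.onFinset_apply]
    split_ifs
    · refine div_le_of_le_mul₀ zero_le zero_le ?_
      rw [← NNReal.coe_le_coe]
      push_cast
      exact Nat.floor_le (by positivity)
    · simp
  · rw [← NNReal.tendsto_coe]
    refine ((tendsto_nat_floor_mul_div_atTop (t z).coe_nonneg).comp
      tendsto_natCast_atTop_atTop).congr' ?_
    filter_upwards [eventually_gt_atTop (max z.1 z.2)] with l hl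
    have : z ∈ Finset.range l ×ˢ Finset.range l := by
      simpa using ⟨(le_max_left _ _).trans_lt hl, (le_max_right _ _).trans_lt hl⟩
    simp only [ratDensity, Finsupp.onFinset_apply, if_pos this, Function.comp_apply]
    push_cast
    rfl

/-- The pull-back of `ratDensity f l` under a discretization map. -/
noncomputable def pulledDensity (idx : X → ℕ) (f : ℕ × ℕ →₀ ℕ) (l : ℕ) (z : X × X) : ℝ≥0∞ :=
  ratDensity f l (idx z.1, idx z.2)

lemma measurable_pulledDensity {idx : X → ℕ} (hidx : Measurable idx) (f : ℕ × ℕ →₀ ℕ) (l : ℕ) :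
    Measurable (pulledDensity idx f l) :=
  (measurable_of_countable (fun z : ℕ × ℕ => (ratDensity f l z : ℝ≥0∞))).comp
    ((hidx.comp measurable_fst).prodMk (hidx.comp measurable_snd))

lemma tendsto_lintegral_one_sub_mul {Q : Measure X} {r : ℕ → X → ℝ≥0∞} {u : X → ℝ≥0∞}
    (hr : ∀ l, Measurable (r l)) (hu : Measurable u) (huQ : ∫⁻ a, u a ∂Q ≠ ∞)
    (h : ∀ᵐ a ∂Q, Tendsto (fun l => r l a) atTop (𝓝 1)) :
    Tendsto (fun l => ∫⁻ a, (1 - r l a) * u a ∂Q) atTop (𝓝 0) := by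
  have := tendsto_lintegral_of_dominated_convergence (μ := Q)
    (F := fun l a => (1 - r l a) * u a) (f := fun _ => 0) u
    (fun l => ((hr l).const_sub 1).mul hu)
    (fun l => Eventually.of_forall fun a => mul_le_of_le_one_left' tsub_le_self) huQ ?_
  · simpa using this
  · filter_upwards [h, ae_lt_top hu huQ] with a ha hua
    have h1 := ENNReal.Tendsto.mul_const (ENNReal.Tendsto.sub tendsto_const_nhds ha
      (Or.inl one_ne_top)) (Or.inr hua.ne) (b := u a)
    simpa using h1

/-- Any coupling is approximated by completions of a countable family of partial couplings. -/
lemma exists_completion_le {Q P : Measure X} [IsProbabilityMeasure Q] [IsProbabilityMeasure P]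
    {π : Measure (X × X)} (h1 : π.map Prod.fst = Q) (h2 : π.map Prod.snd = P)
    {idx : X → ℕ} (hidx : Measurable idx) {c : X × X → ℝ≥0∞} (hc : Measurable c)
    {g : ℕ × ℕ → ℝ≥0∞} (hcg : ∀ z, c z ≤ g (idx z.1, idx z.2))
    {u v : X → ℝ≥0∞} (hu : Measurable u) (hv : Measurable v) (hcuv : ∀ z, c z ≤ u z.1 + v z.2)
    (huQ : ∫⁻ a, u a ∂Q ≠ ∞) (hvP : ∫⁻ b, v b ∂P ≠ ∞) {ε : ℝ≥0∞} (hε : ε ≠ 0) :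
    ∃ f l, IsSubcoupling (pulledDensity idx f l) Q P ∧
      ∫⁻ z, c z ∂completion (pulledDensity idx f l) Q P
        ≤ ∫⁻ z, g (idx z.1, idx z.2) ∂π + ε := by
  have hπ : IsFiniteMeasure π := by
    refine ⟨?_⟩
    have := congrArg (fun m => m Set.univ) h1
    simp only [Measure.map_apply measurable_fst MeasurableSet.univ, Set.preimage_univ,
      measure_univ] at this
    simp [this]
  have hidx2 : Measurable (Prod.map idx idx) := hidx.prodMap hidx
  obtain ⟨t, ht⟩ := exists_density_of_countable (π := π.map (Prod.map idx idx))
  have hf1 : (π.map (Prod.map idx idx)).map Prod.fst = Q.map idx := by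
    rw [Measure.map_map measurable_fst hidx2, ← h1, Measure.map_map hidx measurable_fst]; rfl
  have hf2 : (π.map (Prod.map idx idx)).map Prod.snd = P.map idx := by
    rw [Measure.map_map measurable_snd hidx2, ← h2, Measure.map_map hidx measurable_snd]; rfl
  rw [hf1, hf2] at ht
  have htm : Measurable (fun z => (t z : ℝ≥0∞)) := measurable_of_countable _
  have hg : Measurable g := measurable_of_countable _
  have hq : IsProbabilityMeasure (Q.map idx) := Measure.isProbabilityMeasure_map hidx.aemeasurable
  have hp : IsProbabilityMeasure (P.map idx) := Measure.isProbabilityMeasure_map hidx.aemeasurable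
  have hrow : ∀ᵐ a ∂Q, ∫⁻ b, (t (idx a, idx b) : ℝ≥0∞) ∂P = 1 := by
    filter_upwards [ae_of_ae_map hidx.aemeasurable
      (lintegral_right_eq_one_of_map_fst htm (by rw [← ht, hf1]))] with a ha
    rwa [lintegral_map (measurable_of_countable _) hidx] at ha
  have hcol : ∀ᵐ b ∂P, ∫⁻ a, (t (idx a, idx b) : ℝ≥0∞) ∂Q = 1 := by
    filter_upwards [ae_of_ae_map hidx.aemeasurable
      (lintegral_left_eq_one_of_map_snd htm (by rw [← ht, hf2]))] with b hb
    rwa [lintegral_map (measurable_of_countable _) hidx] at hb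
  obtain ⟨f, hft, hlim⟩ := exists_ratDensity_tendsto t
  set s : ℕ → X × X → ℝ≥0∞ := fun l => pulledDensity idx (f l) l
  have hs : ∀ l, Measurable (s l) := fun l => measurable_pulledDensity hidx _ _
  have hst : ∀ l a b, s l (a, b) ≤ t (idx a, idx b) := fun l a b =>
    ENNReal.coe_le_coe.2 (hft l _)
  have hslim : ∀ a b, Tendsto (fun l => s l (a, b)) atTop (𝓝 (t (idx a, idx b) : ℝ≥0∞)) :=
    fun a b => ENNReal.tendsto_coe.2 (hlim _)
  have hsub : ∀ l, IsSubcoupling (s l) Q P := fun l =>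
    ⟨hrow.mono fun a ha => (lintegral_mono fun b => hst l a b).trans ha.le,
      hcol.mono fun b hb => (lintegral_mono fun a => hst l a b).trans hb.le⟩
  have hrlim : ∀ᵐ a ∂Q, Tendsto (fun l => rowMass (s l) P a) atTop (𝓝 1) := by
    filter_upwards [hrow] with a ha
    rw [← ha]
    exact tendsto_lintegral_of_dominated_convergence _
      (fun l => (hs l).comp measurable_prodMk_left) (fun l => ae_of_all _ fun b => hst l a b)
      (by simp [ha]) (ae_of_all _ fun b => hslim a b)
  have hklim : ∀ᵐ b ∂P, Tendsto (fun l => colMass (s l) Q b) atTop (𝓝 1) := by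
    filter_upwards [hcol] with b hb
    rw [← hb]
    exact tendsto_lintegral_of_dominated_convergence _
      (fun l => (hs l).comp measurable_prodMk_right) (fun l => ae_of_all _ fun a => hst l a b)
      (by simp [hb]) (ae_of_all _ fun a => hslim a b)
  have hrem := (tendsto_lintegral_one_sub_mul (fun l => measurable_rowMass (hs l)) hu huQ
    hrlim).add (tendsto_lintegral_one_sub_mul (fun l => measurable_colMass (hs l)) hv hvP hklim)
  rw [add_zero] at hrem
  obtain ⟨l, hl⟩ := (hrem.eventually (gt_mem_nhds (pos_iff_ne_zero.2 hε))).exists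
  refine ⟨f l, l, hsub l, ?_⟩
  rw [lintegral_completion (hs l) hc]
  refine add_le_add ?_ ((lintegral_remainder_le (hs l) (hsub l) hu hv hcuv).trans hl.le)
  calc ∫⁻ z, s l z * c z ∂Q.prod P
      ≤ ∫⁻ z, t (Prod.map idx idx z) * g (Prod.map idx idx z) ∂Q.prod P :=
        lintegral_mono fun z => mul_le_mul' (hst l z.1 z.2) (hcg z)
    _ = ∫⁻ w, t w * g w ∂(Q.map idx).prod (P.map idx) := by
        rw [Measure.map_prod_map _ _ hidx hidx, lintegral_map (measurable_of_countable _) hidx2]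
    _ = ∫⁻ w, g w ∂π.map (Prod.map idx idx) := by
        rw [ht, lintegral_withDensity_eq_lintegral_mul _ htm hg]; rfl
    _ = ∫⁻ z, g (idx z.1, idx z.2) ∂π := by rw [lintegral_map hg hidx2]; rfl

end Discretization

section Metric

variable {X : Type*} [MetricSpace X] [SecondCountableTopology X] [MeasurableSpace X] [BorelSpace X]

omit [SecondCountableTopology X] [MeasurableSpace X] [BorelSpace X] in
lemma ofReal_dist_sq_le (a b o : X) :
    ENNReal.ofReal (dist a b ^ 2)
      ≤ 2 * ENNReal.ofReal (dist a o ^ 2) + 2 * ENNReal.ofReal (dist b o ^ 2) := by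
  have h2 : (2 : ℝ≥0∞) = ENNReal.ofReal 2 := by simp
  rw [h2, ← ENNReal.ofReal_mul (by norm_num), ← ENNReal.ofReal_mul (by norm_num),
    ← ENNReal.ofReal_add (by positivity) (by positivity)]
  refine ENNReal.ofReal_le_ofReal ?_
  have h := dist_triangle_right a b o
  nlinarith [sq_nonneg (dist a o - dist b o), dist_nonneg (x := a) (y := b)]

lemma measurable_ofReal_dist_sq :
    Measurable fun z : X × X => ENNReal.ofReal (dist z.1 z.2 ^ 2) := by
  fun_prop

lemma measurable_ofReal_dist_sq_left (o : X) :
    Measurable fun a : X => ENNReal.ofReal (dist a o ^ 2) := by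
  fun_prop

lemma exists_measurable_discretization [Nonempty X] {δ : ℝ} (hδ : 0 < δ) :
    ∃ (idx : X → ℕ) (a : ℕ → X), Measurable idx ∧ ∀ x, dist x (a (idx x)) < δ := by
  have hex : ∀ x : X, ∃ n, dist x (TopologicalSpace.denseSeq X n) < δ := fun x => by
    obtain ⟨_, h, n, rfl⟩ := Metric.dense_iff.1 (TopologicalSpace.denseRange_denseSeq X) x δ hδ
    exact ⟨n, by simpa [dist_comm] using h⟩
  refine ⟨fun x => Nat.find (hex x), TopologicalSpace.denseSeq X, measurable_find hex fun k => ?_,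
    fun x => Nat.find_spec (hex x)⟩
  exact measurableSet_lt (by fun_prop) measurable_const

lemma lintegral_dist_sq_snd_ne_top {π : Measure (X × X)} {o : X}
    (hπ : ∫⁻ z, ENNReal.ofReal (dist z.1 z.2 ^ 2) ∂π ≠ ∞)
    (h1 : ∫⁻ a, ENNReal.ofReal (dist a o ^ 2) ∂π.map Prod.fst ≠ ∞) :
    ∫⁻ b, ENNReal.ofReal (dist b o ^ 2) ∂π.map Prod.snd ≠ ∞ := by
  rw [lintegral_map (measurable_ofReal_dist_sq_left o) measurable_fst] at h1
  rw [lintegral_map (measurable_ofReal_dist_sq_left o) measurable_snd]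
  refine ne_top_of_le_ne_top (b := 2 * ∫⁻ z, ENNReal.ofReal (dist z.1 z.2 ^ 2) ∂π
    + 2 * ∫⁻ z, ENNReal.ofReal (dist z.1 o ^ 2) ∂π)
    (add_ne_top.2 ⟨mul_ne_top (by simp) hπ, mul_ne_top (by simp) h1⟩) ?_
  rw [← lintegral_const_mul _ measurable_ofReal_dist_sq,
    ← lintegral_const_mul _ (by fun_prop), ← lintegral_add_left (by fun_prop)]
  refine lintegral_mono fun z => ?_
  have := ofReal_dist_sq_le z.2 o z.1
  rwa [dist_comm z.2 z.1, dist_comm o z.1] at this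

lemma lintegral_dist_sq_fst_ne_top {π : Measure (X × X)} {o : X}
    (hπ : ∫⁻ z, ENNReal.ofReal (dist z.1 z.2 ^ 2) ∂π ≠ ∞)
    (h2 : ∫⁻ b, ENNReal.ofReal (dist b o ^ 2) ∂π.map Prod.snd ≠ ∞) :
    ∫⁻ a, ENNReal.ofReal (dist a o ^ 2) ∂π.map Prod.fst ≠ ∞ := by
  have hs : (π.map Prod.swap).map Prod.fst = π.map Prod.snd :=
    Measure.map_map measurable_fst measurable_swap
  have hf : (π.map Prod.swap).map Prod.snd = π.map Prod.fst :=
    Measure.map_map measurable_snd measurable_swap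
  rw [← hf]
  refine lintegral_dist_sq_snd_ne_top ?_ (by rwa [hs])
  rw [lintegral_map measurable_ofReal_dist_sq measurable_swap]
  simpa [dist_comm] using hπ

omit [SecondCountableTopology X] [BorelSpace X] in
lemma exists_coupling_of_W2sq_lt {Q P : Measure X} {C : ℝ≥0∞} (h : W2sq Q P < C) :
    ∃ π : Measure (X × X), π.map Prod.fst = Q ∧ π.map Prod.snd = P ∧
      ∫⁻ z, ENNReal.ofReal (dist z.1 z.2 ^ 2) ∂π < C := by
  obtain ⟨π, hπ⟩ := iInf_lt_iff.1 h
  obtain ⟨⟨h1, h2⟩, hc⟩ := iInf_lt_iff.1 hπ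
  exact ⟨π, h1, h2, hc⟩

/-- A sequence of discretization maps with mesh tending to zero yields, through completions of
rational partial couplings, countably many couplings whose costs approximate `W2sq Q P`. -/
lemma exists_completion_cost_le {Q P : Measure X} [IsProbabilityMeasure Q]
    [IsProbabilityMeasure P] {o : X}
    (hQ : ∫⁻ a, ENNReal.ofReal (dist a o ^ 2) ∂Q ≠ ∞)
    (hP : ∫⁻ a, ENNReal.ofReal (dist a o ^ 2) ∂P ≠ ∞)
    {δ : ℕ → ℝ} (hδ : ∀ k, 0 < δ k) (hδ0 : Tendsto δ atTop (𝓝 0))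
    {idx : ℕ → X → ℕ} {a : ℕ → ℕ → X} (hidx : ∀ k, Measurable (idx k))
    (ha : ∀ k x, dist x (a k (idx k x)) < δ k) {C : ℝ≥0∞} (hC : W2sq Q P < C) :
    ∃ k f l, IsSubcoupling (pulledDensity (idx k) f l) Q P ∧
      ∫⁻ z, ENNReal.ofReal (dist z.1 z.2 ^ 2) ∂completion (pulledDensity (idx k) f l) Q P ≤ C := by
  obtain ⟨π, h1, h2, hπC⟩ := exists_coupling_of_W2sq_lt hC
  set K := ∫⁻ z, ENNReal.ofReal (dist z.1 z.2 ^ 2) ∂π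
  have hπ : π Set.univ = 1 := by
    rw [← measure_univ (μ := Q), ← h1, Measure.map_apply measurable_fst MeasurableSet.univ,
      Set.preimage_univ]
  have hlim : Tendsto (fun k => ENNReal.ofReal (1 + δ k) * K
      + ENNReal.ofReal (16 * δ k * (1 + δ k))) atTop (𝓝 K) := by
    have e1 : Tendsto (fun k => ENNReal.ofReal (1 + δ k)) atTop (𝓝 1) := by
      simpa using ENNReal.tendsto_ofReal (hδ0.const_add 1)
    have e2 : Tendsto (fun k => ENNReal.ofReal (16 * δ k * (1 + δ k))) atTop (𝓝 0) := by
      simpa using ENNReal.tendsto_ofReal ((hδ0.const_mul 16).mul (hδ0.const_add 1))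
    simpa using (ENNReal.Tendsto.mul_const e1 (Or.inl one_ne_zero) (b := K)).add e2
  obtain ⟨k, hk⟩ := (hlim.eventually (gt_mem_nhds hπC)).exists
  set V := ENNReal.ofReal (1 + δ k) * K + ENNReal.ofReal (16 * δ k * (1 + δ k))
  obtain ⟨f, l, hsub, hle⟩ := exists_completion_le h1 h2 (hidx k)
    (measurable_ofReal_dist_sq (X := X))
    (g := fun w => ENNReal.ofReal ((dist (a k w.1) (a k w.2) + 2 * δ k) ^ 2))
    (u := fun x => 2 * ENNReal.ofReal (dist x o ^ 2))
    (v := fun x => 2 * ENNReal.ofReal (dist x o ^ 2))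
    (fun z => by
      refine ENNReal.ofReal_le_ofReal (pow_le_pow_left₀ dist_nonneg ?_ 2)
      have := dist_triangle4_right z.1 z.2 (a k (idx k z.1)) (a k (idx k z.2))
      linarith [ha k z.1, ha k z.2])
    (by fun_prop) (by fun_prop) (fun z => ofReal_dist_sq_le _ _ _)
    (by rw [lintegral_const_mul _ (by fun_prop)]; exact mul_ne_top (by simp) hQ)
    (by rw [lintegral_const_mul _ (by fun_prop)]; exact mul_ne_top (by simp) hP)
    (tsub_pos_of_lt hk).ne'
  refine ⟨k, f, l, hsub, hle.trans ((add_le_add ?_ le_rfl).trans_eq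
    (add_tsub_cancel_of_le hk.le))⟩
  refine le_trans (lintegral_mono (g := fun z : X × X => ENNReal.ofReal (1 + δ k) *
    ENNReal.ofReal (dist z.1 z.2 ^ 2) + ENNReal.ofReal (16 * δ k * (1 + δ k)))
    fun z => ?_) (le_of_eq ?_)
  · have hk0 := hδ k
    beta_reduce
    rw [← ENNReal.ofReal_mul (by positivity), ← ENNReal.ofReal_add (by positivity) (by positivity)]
    refine ENNReal.ofReal_le_ofReal ?_
    have h4 : dist (a k (idx k z.1)) (a k (idx k z.2)) + 2 * δ k ≤ dist z.1 z.2 + 4 * δ k := by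
      have := dist_triangle4 (a k (idx k z.1)) z.1 z.2 (a k (idx k z.2))
      rw [dist_comm _ z.1] at this
      linarith [ha k z.1, ha k z.2]
    refine (pow_le_pow_left₀ (by positivity) h4 2).trans ?_
    nlinarith [mul_nonneg hk0.le (sq_nonneg (dist z.1 z.2 - 4))]
  · rw [lintegral_add_right _ measurable_const, lintegral_const_mul _ measurable_ofReal_dist_sq,
      lintegral_const, hπ, mul_one]

end Metric

section Selection

variable {Ω X : Type*} [MeasurableSpace Ω] [MeasurableSpace X]

lemma map_bind_measure {Y : Type*} [MeasurableSpace Y] {ν : Measure Ω} {κ : Ω → Measure X}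
    (hκ : Measurable κ) {f : X → Y} (hf : Measurable f) :
    (ν.bind κ).map f = ν.bind fun x => (κ x).map f := by
  have hm : Measurable fun x => (κ x).map f := (Measure.measurable_map f hf).comp hκ
  ext A hA
  rw [Measure.map_apply hf hA, Measure.bind_apply (hf hA) hκ.aemeasurable,
    Measure.bind_apply hA hm.aemeasurable]
  simp only [Measure.map_apply hf hA]

/-- If countably many measurable families of couplings suffice to bound the transport cost
fibrewise by `h`, then the mixtures can be coupled with cost at most `∫ h dν`. -/
lemma W2sq_bind_le {ι : Type*} [Countable ι] [Nonempty ι] [MetricSpace X]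
    [SecondCountableTopology X] [BorelSpace X] {ν : Measure Ω} {Q P : Ω → Measure X}
    {κ : ι → Ω → Measure (X × X)} (hκ : ∀ i, Measurable (κ i)) {B : ι → Set Ω}
    (hB : ∀ i, MeasurableSet (B i)) {h : Ω → ℝ≥0∞}
    (hBκ : ∀ i, ∀ x ∈ B i, (κ i x).map Prod.fst = Q x ∧ (κ i x).map Prod.snd = P x ∧
      ∫⁻ z, ENNReal.ofReal (dist z.1 z.2 ^ 2) ∂κ i x ≤ h x)
    (hcov : ∀ᵐ x ∂ν, ∃ i, x ∈ B i) :
    W2sq (ν.bind Q) (ν.bind P) ≤ ∫⁻ x, h x ∂ν := by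
  obtain ⟨e, he⟩ := exists_surjective_nat ι
  have hex : ∀ x, ∃ n, x ∈ B (e n) ∨ x ∉ ⋃ i, B i := fun x => by
    by_cases hx : x ∈ ⋃ i, B i
    · obtain ⟨i, hi⟩ := Set.mem_iUnion.1 hx
      obtain ⟨n, rfl⟩ := he i
      exact ⟨n, Or.inl hi⟩
    · exact ⟨0, Or.inr hx⟩
  have hn : Measurable fun x => Nat.find (hex x) := measurable_find hex fun n =>
    (hB (e n)).union (MeasurableSet.iUnion hB).compl
  set K : Ω → Measure (X × X) := fun x => κ (e (Nat.find (hex x))) x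
  have hK : Measurable K := (measurable_from_prod_countable_left
    (f := fun p : Ω × ℕ => κ (e p.2) p.1) fun n => hκ (e n)).comp (measurable_id.prodMk hn)
  have hKB : ∀ᵐ x ∂ν, x ∈ B (e (Nat.find (hex x))) := by
    filter_upwards [hcov] with x hx
    exact (Nat.find_spec (hex x)).resolve_right fun h => h (Set.mem_iUnion.2 hx)
  refine iInf₂_le_of_le (ν.bind K) ⟨?_, ?_⟩ ?_
  · rw [map_bind_measure hK measurable_fst]
    exact Measure.bind_congr_right (hKB.mono fun x hx => (hBκ _ x hx).1)
  · rw [map_bind_measure hK measurable_snd]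
    exact Measure.bind_congr_right (hKB.mono fun x hx => (hBκ _ x hx).2.1)
  · rw [Measure.lintegral_bind hK.aemeasurable measurable_ofReal_dist_sq.aemeasurable]
    exact lintegral_mono_ae (hKB.mono fun x hx => (hBκ _ x hx).2.2)

variable {Y : Type*} [MeasurableSpace Y] {s : X × Y → ℝ≥0∞}

lemma measurable_rowMass_kernel (P : Kernel Ω Y) [IsMarkovKernel P] (hs : Measurable s) :
    Measurable fun p : Ω × X => rowMass s (P p.1) p.2 :=
  Measurable.lintegral_kernel_prod_right (κ := P.comap Prod.fst measurable_fst)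
    (f := fun (p : Ω × X) b => s (p.2, b)) (by fun_prop)

lemma measurable_colMass_kernel (Q : Kernel Ω X) [IsMarkovKernel Q] (hs : Measurable s) :
    Measurable fun p : Ω × Y => colMass s (Q p.1) p.2 :=
  Measurable.lintegral_kernel_prod_right (κ := Q.comap Prod.fst measurable_fst)
    (f := fun (p : Ω × Y) a => s (a, p.2)) (by fun_prop)

lemma measurable_completion (Q : Kernel Ω X) (P : Kernel Ω Y) [IsMarkovKernel Q]
    [IsMarkovKernel P] (hs : Measurable s) : Measurable fun x => completion s (Q x) (P x) := by
  have hr := measurable_rowMass_kernel P hs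
  have hk := measurable_colMass_kernel Q hs
  have hd : Measurable fun x => defect s (Q x) (P x) :=
    Measurable.lintegral_kernel_prod_right (κ := Q)
      (f := fun x a => 1 - rowMass s (P x) a) (hr.const_sub 1)
  have hD : Measurable (Function.uncurry fun x z => completedDensity s (Q x) (P x) z) := by
    refine (hs.comp measurable_snd).add (Measurable.div (Measurable.mul ?_ ?_)
      (hd.comp measurable_fst))
    · exact (hr.comp (measurable_fst.prodMk (measurable_fst.comp measurable_snd))).const_sub 1
    · exact (hk.comp (measurable_fst.prodMk (measurable_snd.comp measurable_snd))).const_sub 1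
  convert ((Q ×ₖ P).withDensity fun x z => completedDensity s (Q x) (P x) z).measurable using 2
    with x
  rw [Kernel.withDensity_apply _ hD, Kernel.prod_apply]
  rfl

lemma measurableSet_isSubcoupling (Q : Kernel Ω X) (P : Kernel Ω Y) [IsMarkovKernel Q]
    [IsMarkovKernel P] (hs : Measurable s) :
    MeasurableSet {x | IsSubcoupling s (Q x) (P x)} := by
  have h1 : MeasurableSet {p : Ω × X | ¬ rowMass s (P p.1) p.2 ≤ 1} :=
    (measurableSet_le (measurable_rowMass_kernel P hs) measurable_const).compl
  have h2 : MeasurableSet {p : Ω × Y | ¬ colMass s (Q p.1) p.2 ≤ 1} :=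
    (measurableSet_le (measurable_colMass_kernel Q hs) measurable_const).compl
  exact ((Kernel.measurable_kernel_prodMk_left h1) (measurableSet_singleton 0)).inter
    ((Kernel.measurable_kernel_prodMk_left h2) (measurableSet_singleton 0))

/-- Convexity of the squared Wasserstein distance under mixtures, with a measurable bound on the
fibrewise distances. -/
lemma W2sq_bind_le_lintegral_add [MetricSpace X] [SecondCountableTopology X] [BorelSpace X]
    [Nonempty X] {ν : Measure Ω} [IsProbabilityMeasure ν] (Q P : Kernel Ω X) [IsMarkovKernel Q]
    [IsMarkovKernel P] {h : Ω → ℝ≥0∞} (hh : Measurable h) (o : X)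
    (hν : ∀ᵐ x ∂ν, W2sq (Q x) (P x) ≤ h x ∧ h x ≠ ∞ ∧
      ∫⁻ a, ENNReal.ofReal (dist a o ^ 2) ∂Q x ≠ ∞ ∧ ∫⁻ a, ENNReal.ofReal (dist a o ^ 2) ∂P x ≠ ∞) :
    W2sq (ν.bind Q) (ν.bind P) ≤ ∫⁻ x, h x ∂ν := by
  have hδ : ∀ k : ℕ, (0 : ℝ) < 1 / ((k : ℝ) + 1) := fun k => Nat.one_div_pos_of_nat
  choose idx a hidx ha using fun k : ℕ => exists_measurable_discretization (X := X) (hδ k)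
  refine ENNReal.le_of_forall_pos_le_add fun ε hε _ => ?_
  have hs : ∀ i : ℕ × (ℕ × ℕ →₀ ℕ) × ℕ, Measurable (pulledDensity (idx i.1) i.2.1 i.2.2) :=
    fun i => measurable_pulledDensity (hidx _) _ _
  have hκ := fun i => measurable_completion Q P (hs i)
  refine (W2sq_bind_le (h := fun x => h x + ε) hκ
    (B := fun i => {x | IsSubcoupling (pulledDensity (idx i.1) i.2.1 i.2.2) (Q x) (P x)} ∩
      {x | ∫⁻ z, ENNReal.ofReal (dist z.1 z.2 ^ 2)
        ∂completion (pulledDensity (idx i.1) i.2.1 i.2.2) (Q x) (P x) ≤ h x + ε})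
    (fun i => (measurableSet_isSubcoupling Q P (hs i)).inter (measurableSet_le
      ((Measure.measurable_lintegral measurable_ofReal_dist_sq).comp (hκ i))
      (hh.add_const _))) ?_ ?_).trans (le_of_eq ?_)
  · exact fun i x hx => ⟨map_fst_completion (hs i) hx.1, map_snd_completion (hs i) hx.1, hx.2⟩
  · filter_upwards [hν] with x hx
    obtain ⟨k, f, l, h1, h2⟩ := exists_completion_cost_le hx.2.2.1 hx.2.2.2 hδ
      tendsto_one_div_add_atTop_nhds_zero_nat hidx ha
      (hx.1.trans_lt (ENNReal.lt_add_right hx.2.1 (ENNReal.coe_pos.2 hε).ne'))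
    exact ⟨(k, f, l), h1, h2⟩
  · rw [lintegral_add_right _ measurable_const]
    simp

end Selection

section Entropy

open InformationTheory

variable {X : Type*} [MeasurableSpace X]

lemma relEntropy_withDensity {P : Measure X} [SigmaFinite P] {f : X → ℝ≥0∞} (hf : Measurable f) :
    relEntropy (P.withDensity f) P = ∫⁻ a, ENNReal.ofReal (klFun (f a).toReal) ∂P := by
  rw [relEntropy, if_pos (withDensity_absolutelyContinuous _ _)]
  refine lintegral_congr_ae ?_
  filter_upwards [Measure.rnDeriv_withDensity P hf] with a ha
  rw [ha, klFun]
  ring_nf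

lemma mul_klFun_div_add_le {f b : ℝ} (hb : 0 < b) :
    b * klFun (f / b) + f * (Real.log b)⁺ + b * (Real.log b)⁻
      ≤ klFun f + f * (Real.log b)⁻ + b * (Real.log b)⁺ := by
  have h1 : b * klFun (f / b) = f * Real.log f - f * Real.log b + b - f := by
    rcases eq_or_ne f 0 with rfl | hf
    · simp [klFun]
    · rw [klFun, Real.log_div hf hb.ne']
      field_simp
  have h2 : 0 ≤ klFun b := klFun_nonneg hb.le
  have h3 : Real.log b = (Real.log b)⁺ - (Real.log b)⁻ := (posPart_sub_negPart _).symm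
  rw [h1]
  simp only [klFun] at h2 ⊢
  generalize (Real.log b)⁺ = u at *
  generalize (Real.log b)⁻ = v at *
  generalize Real.log b = l at *
  subst h3
  linarith

/-- The relative entropy of the normalized density is controlled by that of the density. -/
lemma lintegral_mul_lintegral_klFun_div_le {P : Measure X} [IsProbabilityMeasure P]
    {f : X → ℝ≥0∞} (hf : Measurable f) (h0 : ∫⁻ a, f a ∂P ≠ 0) (htop : ∫⁻ a, f a ∂P ≠ ∞) :
    (∫⁻ a, f a ∂P) * ∫⁻ a, ENNReal.ofReal (klFun (f a / ∫⁻ b, f b ∂P).toReal) ∂P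
      ≤ ∫⁻ a, ENNReal.ofReal (klFun (f a).toReal) ∂P := by
  set p := ∫⁻ a, f a ∂P with hp
  have hb : 0 < p.toReal := ENNReal.toReal_pos h0 htop
  set L := Real.log p.toReal
  have hm1 : Measurable fun a => ENNReal.ofReal (klFun (f a / p).toReal) :=
    (measurable_klFun.comp (hf.div_const p).ennreal_toReal).ennreal_ofReal
  have hm2 : Measurable fun a => ENNReal.ofReal (klFun (f a).toReal) :=
    (measurable_klFun.comp hf.ennreal_toReal).ennreal_ofReal
  have key : ∫⁻ a, (p * ENNReal.ofReal (klFun (f a / p).toReal) + f a * ENNReal.ofReal L⁺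
        + p * ENNReal.ofReal L⁻) ∂P
      ≤ ∫⁻ a, (ENNReal.ofReal (klFun (f a).toReal) + f a * ENNReal.ofReal L⁻
        + p * ENNReal.ofReal L⁺) ∂P := by
    refine lintegral_mono_ae ?_
    filter_upwards [ae_lt_top hf htop] with a ha
    have hk1 : 0 ≤ klFun ((f a).toReal / p.toReal) := klFun_nonneg (by positivity)
    have hk2 : 0 ≤ klFun (f a).toReal := klFun_nonneg (by positivity)
    have hpos := posPart_nonneg L
    have hneg := negPart_nonneg L
    rw [ENNReal.toReal_div, ← ENNReal.ofReal_toReal ha.ne, ← ENNReal.ofReal_toReal htop,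
      ENNReal.toReal_ofReal ENNReal.toReal_nonneg, ENNReal.toReal_ofReal ENNReal.toReal_nonneg]
    simp only [← ENNReal.ofReal_mul ENNReal.toReal_nonneg]
    rw [← ENNReal.ofReal_add (by positivity) (by positivity),
      ← ENNReal.ofReal_add (by positivity) (by positivity),
      ← ENNReal.ofReal_add (by positivity) (by positivity),
      ← ENNReal.ofReal_add (by positivity) (by positivity)]
    exact ENNReal.ofReal_le_ofReal (mul_klFun_div_add_le hb)
  rw [lintegral_add_right _ measurable_const, lintegral_add_right _ (hf.mul_const _),
    lintegral_add_right _ measurable_const, lintegral_add_right _ (hf.mul_const _),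
    lintegral_const_mul _ hm1, lintegral_mul_const _ hf, lintegral_mul_const _ hf, ← hp,
    lintegral_const, lintegral_const, measure_univ, mul_one, mul_one, add_assoc, add_assoc,
    add_comm (p * ENNReal.ofReal L⁻)] at key
  exact (ENNReal.add_le_add_iff_right
    (add_ne_top.2 ⟨mul_ne_top htop ofReal_ne_top, mul_ne_top htop ofReal_ne_top⟩)).1 key

/-- A transport-entropy inequality forces finite second moments. -/
lemma lintegral_dist_sq_ne_top_of_talagrand [MetricSpace X] [SecondCountableTopology X]
    [BorelSpace X] {P : Measure X} [IsProbabilityMeasure P] {C : ℝ≥0∞} (hC : C ≠ ∞)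
    (h : ∀ Q : Measure X, IsProbabilityMeasure Q → W2sq Q P ≤ C * relEntropy Q P) (o : X) :
    ∫⁻ a, ENNReal.ofReal (dist a o ^ 2) ∂P ≠ ∞ := by
  obtain ⟨n, hn⟩ : ∃ n : ℕ, P (Metric.ball o n) ≠ 0 := by
    by_contra! hcon
    have := measure_iUnion_null hcon
    rw [Metric.iUnion_ball_nat, measure_univ] at this
    exact one_ne_zero this
  set A := Metric.ball o (n : ℝ)
  have hAm : MeasurableSet A := measurableSet_ball
  set f : X → ℝ≥0∞ := A.indicator fun _ => (P A)⁻¹ with hf_def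
  have hf : Measurable f := measurable_const.indicator hAm
  have hprob : IsProbabilityMeasure (P.withDensity f) := ⟨by
    rw [withDensity_apply _ MeasurableSet.univ, Measure.restrict_univ, lintegral_indicator hAm,
      setLIntegral_const, ENNReal.inv_mul_cancel hn (measure_ne_top P A)]⟩
  have hent : relEntropy (P.withDensity f) P ≠ ∞ := by
    rw [relEntropy_withDensity hf]
    refine ne_top_of_le_ne_top (b := ENNReal.ofReal (klFun 0) +
      ENNReal.ofReal (klFun ((P A)⁻¹).toReal)) (by simp) ?_
    refine (lintegral_mono (g := fun _ => ENNReal.ofReal (klFun 0) +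
      ENNReal.ofReal (klFun ((P A)⁻¹).toReal)) fun a => ?_).trans (by simp)
    by_cases ha : a ∈ A
    · simp only [hf_def, Set.indicator_of_mem ha]
      exact le_add_self
    · simp only [hf_def, Set.indicator_of_notMem ha, ENNReal.toReal_zero]
      exact le_self_add
  obtain ⟨π, h1, h2, hπ⟩ := exists_coupling_of_W2sq_lt
    ((h _ hprob).trans_lt (mul_ne_top hC hent).lt_top)
  rw [← h2]
  refine lintegral_dist_sq_snd_ne_top hπ.ne ?_
  rw [h1, lintegral_withDensity_eq_lintegral_mul _ hf (measurable_ofReal_dist_sq_left o)]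
  refine ne_top_of_le_ne_top (b := (P A)⁻¹ * ENNReal.ofReal ((n : ℝ) ^ 2))
    (mul_ne_top (ENNReal.inv_ne_top.2 hn) ofReal_ne_top) ?_
  refine (lintegral_mono (g := fun _ => (P A)⁻¹ * ENNReal.ofReal ((n : ℝ) ^ 2)) fun a => ?_).trans
    (by simp)
  by_cases ha : a ∈ A
  · simp only [Pi.mul_apply, hf_def, Set.indicator_of_mem ha]
    gcongr
    exact (Metric.mem_ball.1 ha).le
  · simp [hf_def, Set.indicator_of_notMem ha]

end Entropy

section Disintegration

open InformationTheory

variable {Ω X : Type*} [MeasurableSpace Ω] [MeasurableSpace X]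

/-- The density of `F · P^x`, normalized to a probability density whenever possible. -/
noncomputable def normalizedDensity (P : Kernel Ω X) (F : X → ℝ≥0∞) (x : Ω) (a : X) : ℝ≥0∞ :=
  if ∫⁻ b, F b ∂P x = 0 ∨ ∫⁻ b, F b ∂P x = ∞ then 1 else F a / ∫⁻ b, F b ∂P x

lemma measurable_normalizedDensity (P : Kernel Ω X) {F : X → ℝ≥0∞} (hF : Measurable F) :
    Measurable (Function.uncurry (normalizedDensity P F)) := by
  have hp : Measurable fun z : Ω × X => ∫⁻ b, F b ∂P z.1 := hF.lintegral_kernel.comp measurable_fst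
  exact Measurable.ite ((hp (measurableSet_singleton 0)).union (hp (measurableSet_singleton ∞)))
    measurable_const ((hF.comp measurable_snd).div hp)

/-- The conditional laws of `F · P^μ` given the mixing variable. -/
noncomputable def conditionedKernel (P : Kernel Ω X) [IsMarkovKernel P] (F : X → ℝ≥0∞) :
    Kernel Ω X :=
  P.withDensity (normalizedDensity P F)

variable (P : Kernel Ω X) [IsMarkovKernel P] {F : X → ℝ≥0∞}

lemma conditionedKernel_apply (hF : Measurable F) (x : Ω) :
    conditionedKernel P F x = (P x).withDensity (normalizedDensity P F x) :=
  Kernel.withDensity_apply _ (measurable_normalizedDensity P hF) x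

lemma isMarkovKernel_conditionedKernel (hF : Measurable F) :
    IsMarkovKernel (conditionedKernel P F) := by
  refine ⟨fun x => ⟨?_⟩⟩
  rw [conditionedKernel_apply P hF, withDensity_apply _ MeasurableSet.univ, Measure.restrict_univ]
  unfold normalizedDensity
  split_ifs with h
  · simp
  · push Not at h
    simp only [div_eq_mul_inv]
    rw [lintegral_mul_const _ hF, ENNReal.mul_inv_cancel h.1 h.2]

lemma mul_conditionedKernel_apply (hF : Measurable F) {x : Ω} (hx : ∫⁻ b, F b ∂P x ≠ ∞)
    {A : Set X} (hA : MeasurableSet A) :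
    (∫⁻ b, F b ∂P x) * conditionedKernel P F x A = ∫⁻ a in A, F a ∂P x := by
  by_cases h0 : ∫⁻ b, F b ∂P x = 0
  · rw [h0, zero_mul]
    exact (le_antisymm ((setLIntegral_le_lintegral _ _).trans h0.le) zero_le).symm
  · rw [conditionedKernel_apply P hF, withDensity_apply _ hA]
    simp only [normalizedDensity, h0, hx, or_self, if_false, div_eq_mul_inv]
    rw [lintegral_mul_const _ hF, mul_comm, mul_assoc, ENNReal.inv_mul_cancel h0 hx, mul_one]

omit [IsMarkovKernel P] in
lemma ae_lintegral_ne_top {μ : Measure Ω} (hF : Measurable F) (h : ∫⁻ a, F a ∂μ.bind P ≠ ∞) :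
    ∀ᵐ x ∂μ, ∫⁻ a, F a ∂P x ≠ ∞ := by
  rw [Measure.lintegral_bind P.measurable.aemeasurable hF.aemeasurable] at h
  exact (ae_lt_top hF.lintegral_kernel h).mono fun x hx => hx.ne

lemma withDensity_bind_eq {μ : Measure Ω} (hF : Measurable F)
    (h : ∫⁻ a, F a ∂μ.bind P ≠ ∞) :
    (μ.bind P).withDensity F
      = (μ.withDensity fun x => ∫⁻ a, F a ∂P x).bind (conditionedKernel P F) := by
  ext A hA
  rw [withDensity_apply _ hA, ← lintegral_indicator hA,
    Measure.lintegral_bind P.measurable.aemeasurable (hF.indicator hA).aemeasurable,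
    Measure.bind_apply hA (conditionedKernel P F).measurable.aemeasurable,
    lintegral_withDensity_eq_lintegral_mul _ hF.lintegral_kernel
      (Kernel.measurable_coe _ hA)]
  refine lintegral_congr_ae ?_
  filter_upwards [ae_lintegral_ne_top P hF h] with x hx
  rw [Pi.mul_apply, mul_conditionedKernel_apply P hF hx hA, lintegral_indicator hA]

lemma relEntropy_conditionedKernel (hF : Measurable F) (x : Ω) :
    relEntropy (conditionedKernel P F x) (P x)
      = ∫⁻ a, ENNReal.ofReal (klFun (normalizedDensity P F x a).toReal) ∂P x := by
  rw [conditionedKernel_apply P hF,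
    relEntropy_withDensity (measurable_normalizedDensity P hF).of_uncurry_left]

lemma measurable_relEntropy_conditionedKernel (hF : Measurable F) :
    Measurable fun x => relEntropy (conditionedKernel P F x) (P x) := by
  simp only [relEntropy_conditionedKernel P hF]
  exact Measurable.lintegral_kernel_prod_right (measurable_klFun.comp
    (measurable_normalizedDensity P hF).ennreal_toReal).ennreal_ofReal

/-- The mean conditional entropy is at most the entropy of the mixture. -/
lemma lintegral_relEntropy_conditionedKernel_le {μ : Measure Ω} [IsProbabilityMeasure μ]
    (hF : Measurable F) (h : ∫⁻ a, F a ∂μ.bind P ≠ ∞) :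
    ∫⁻ x, relEntropy (conditionedKernel P F x) (P x) ∂(μ.withDensity fun x => ∫⁻ a, F a ∂P x)
      ≤ relEntropy ((μ.bind P).withDensity F) (μ.bind P) := by
  have hm : Measurable fun a => ENNReal.ofReal (klFun (F a).toReal) :=
    (measurable_klFun.comp hF.ennreal_toReal).ennreal_ofReal
  rw [relEntropy_withDensity hF,
    Measure.lintegral_bind P.measurable.aemeasurable hm.aemeasurable,
    lintegral_withDensity_eq_lintegral_mul _ hF.lintegral_kernel
      (measurable_relEntropy_conditionedKernel P hF)]
  refine lintegral_mono_ae ?_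
  filter_upwards [ae_lintegral_ne_top P hF h] with x hx
  by_cases h0 : ∫⁻ b, F b ∂P x = 0
  · simp [h0]
  · rw [Pi.mul_apply, relEntropy_conditionedKernel P hF]
    simp only [normalizedDensity, h0, hx, or_self, if_false]
    exact lintegral_mul_lintegral_klFun_div_le hF h0 hx

/-- A transport-entropy inequality holding for every component of a mixture bounds the distance
from a reweighted mixture to the mixture with the same mixing law. -/
theorem W2sq_withDensity_bind_le [MetricSpace X] [SecondCountableTopology X] [BorelSpace X]
    {μ : Measure Ω} [IsProbabilityMeasure μ] {C : ℝ≥0∞} (hC0 : C ≠ 0) (hC : C ≠ ∞)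
    (hP : ∀ x, ∀ Q : Measure X, IsProbabilityMeasure Q → W2sq Q (P x) ≤ C * relEntropy Q (P x))
    (hF : Measurable F) (hF1 : ∫⁻ a, F a ∂μ.bind P = 1) :
    W2sq ((μ.bind P).withDensity F) ((μ.withDensity fun x => ∫⁻ a, F a ∂P x).bind P)
      ≤ C * relEntropy ((μ.bind P).withDensity F) (μ.bind P) := by
  have hFtop : ∫⁻ a, F a ∂μ.bind P ≠ ∞ := by simp [hF1]
  obtain ⟨x₀⟩ := nonempty_of_isProbabilityMeasure μ
  obtain ⟨o⟩ := nonempty_of_isProbabilityMeasure (P x₀)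
  have : Nonempty X := ⟨o⟩
  by_cases hH : relEntropy ((μ.bind P).withDensity F) (μ.bind P) = ∞
  · simp [hH, ENNReal.mul_top hC0]
  set ν := μ.withDensity fun x => ∫⁻ a, F a ∂P x with hν
  have hνprob : IsProbabilityMeasure ν := ⟨by
    rw [hν, withDensity_apply _ MeasurableSet.univ, Measure.restrict_univ, ← hF1,
      Measure.lintegral_bind P.measurable.aemeasurable hF.aemeasurable]⟩
  have := isMarkovKernel_conditionedKernel P hF
  have hent := measurable_relEntropy_conditionedKernel P hF
  have hle := lintegral_relEntropy_conditionedKernel_le P (μ := μ) hF hFtop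
  rw [withDensity_bind_eq P hF hFtop, ← hν] at hle hH ⊢
  refine (W2sq_bind_le_lintegral_add (conditionedKernel P F) P (hent.const_mul C) o ?_).trans ?_
  · filter_upwards [ae_lt_top hent (ne_top_of_le_ne_top hH hle)] with x hx
    have hW := hP x (conditionedKernel P F x) inferInstance
    have hfin : C * relEntropy (conditionedKernel P F x) (P x) ≠ ∞ := mul_ne_top hC hx.ne
    have hmom := lintegral_dist_sq_ne_top_of_talagrand hC (hP x) o
    obtain ⟨π, h1, h2, hπ⟩ := exists_coupling_of_W2sq_lt (hW.trans_lt hfin.lt_top)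
    refine ⟨hW, hfin, ?_, hmom⟩
    rw [← h1]
    exact lintegral_dist_sq_fst_ne_top hπ.ne (by rwa [h2])
  · rw [lintegral_const_mul _ hent]
    gcongr

end Disintegration

/-- **Estimate (2.8).** If each `P^x` satisfies the Talagrand inequality
`W_{2,T}(Q',P^x)² ≤ c₁ H(Q'|P^x)`, then for `Q = F·P^μ` with `∫ F dP^μ = 1`,
`p(x) = ∫ F dP^x` and `ν = p·μ`, one has `W_{2,T}(Q,P^ν)² ≤ c₁ H(Q|P^μ)`. -/
theorem wasserstein_to_conditioned_mixture
    {E : Type*} [MetricSpace E] [PolishSpace E] [MeasurableSpace E] [BorelSpace E]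
    (T : ℝ) (hT : 0 < T)
    (P : E → Measure (PathSpace E T))
    (hPmeas : Measurable P)
    (hPprob : ∀ x, IsProbabilityMeasure (P x))
    (hP0 : ∀ x : E,
      (P x).map (fun ξ : PathSpace E T => ξ ⟨0, Set.left_mem_Icc.mpr hT.le⟩) = Measure.dirac x)
    (c₁ : ℝ) (hc₁ : 0 < c₁)
    (hTCIx : ∀ x : E, ∀ Q' : Measure (PathSpace E T), IsProbabilityMeasure Q' →
      W2sq Q' (P x) ≤ ENNReal.ofReal c₁ * relEntropy Q' (P x))
    (μ : Measure E) [IsProbabilityMeasure μ]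
    (F : PathSpace E T → ℝ≥0∞) (hF : Measurable F)
    (hF1 : ∫⁻ ξ, F ξ ∂(μ.bind P) = 1) :
    W2sq ((μ.bind P).withDensity F)
        ((μ.withDensity (fun x => ∫⁻ ξ, F ξ ∂(P x))).bind P)
      ≤ ENNReal.ofReal c₁ * relEntropy ((μ.bind P).withDensity F) (μ.bind P) := by
  have : IsMarkovKernel (⟨P, hPmeas⟩ : Kernel E (PathSpace E T)) := ⟨hPprob⟩
  exact W2sq_withDensity_bind_le ⟨P, hPmeas⟩ (by simpa using hc₁) ofReal_ne_top hTCIx hF hF1
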